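/- (Curvature variation formula, Proposition 2.3, at the interior vertex of a star triangulation.) Let (x, y) be a generalized PL metric on the star triangulation of an n-gon (n ≥ 3). Let w₀ : ℝ → ℝ and w : ℝ → (ℤ/nℤ → ℝ) be differentiable at t₀, and suppose that at t₀ the vertex-scaled lengths (x_i(w(t₀)), x_{i+1}(w(t₀)), y_i(w(t₀))) (scaled using w₀(t₀) at v₀) satisfy the strict triangle inequalities for every i. Then the cone angle t ↦ α(w₀(t), w(t)) is differentiable at t₀ with derivative Σ_{i ∈ ℤ/nℤ} (cot(a_i) + cot(b_i)) · (w_i′(t₀) − w₀′(t₀)), where the angles a_i, b_i are taken in the scaled metric at time t₀; equivalently, the discrete curvature K₀ = 2π − α at v₀ satisfies dK₀/dt = Σ_{i} (cot(a_i) + cot(b_i)) · (w₀′(t₀) − w_i′(t₀)). -/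

import Mathlib

open Real

/-- The inner angle opposite the side of length `r` in a generalized triangle with
side lengths `p`, `q`, `r` (law of cosines). -/
noncomputable def triAngle (p q r : ℝ) : ℝ :=
  Real.arccos ((p ^ 2 + q ^ 2 - r ^ 2) / (2 * p * q))

/-- Positive reals `p, q, r` satisfying the weak triangle inequalities
(a generalized triangle). -/
def IsGenTri (p q r : ℝ) : Prop :=
  0 < p ∧ 0 < q ∧ 0 < r ∧ p ≤ q + r ∧ q ≤ p + r ∧ r ≤ p + q

/-! Star triangulation of an `n`-gon: interior vertex `v₀`, boundary vertices
`vᵢ, i ∈ ℤ/nℤ`, triangles `Δ v₀ vᵢ v_{i+1}`; `x i` is the length of `v₀vᵢ` and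
`y i` the length of `vᵢv_{i+1}`.  Conformal factors: `w0` at `v₀`, `w i` at `vᵢ`. -/

/-- Scaled length of the edge `v₀ vᵢ`. -/
noncomputable def Xl (n : ℕ) (x : ZMod n → ℝ) (w0 : ℝ) (w : ZMod n → ℝ) (i : ZMod n) : ℝ :=
  Real.exp (w0 + w i) * x i

/-- Scaled length of the edge `vᵢ v_{i+1}`. -/
noncomputable def Yl (n : ℕ) (y : ZMod n → ℝ) (w : ZMod n → ℝ) (i : ZMod n) : ℝ :=
  Real.exp (w i + w (i + 1)) * y i

/-- The angle `cᵢ(w)` at `v₀` in the triangle `Δ v₀ vᵢ v_{i+1}` in the scaled metric. -/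
noncomputable def cAng (n : ℕ) (x y : ZMod n → ℝ) (w0 : ℝ) (w : ZMod n → ℝ) (i : ZMod n) : ℝ :=
  triAngle (Xl n x w0 w i) (Xl n x w0 w (i + 1)) (Yl n y w i)

/-- The angle `aᵢ(w)` at `v_{i+1}` in the triangle `Δ v₀ vᵢ v_{i+1}` in the scaled metric. -/
noncomputable def aAng (n : ℕ) (x y : ZMod n → ℝ) (w0 : ℝ) (w : ZMod n → ℝ) (i : ZMod n) : ℝ :=
  triAngle (Xl n x w0 w (i + 1)) (Yl n y w i) (Xl n x w0 w i)

/-- The angle `bᵢ(w)` at `v_{i-1}` in the triangle `Δ v₀ v_{i-1} vᵢ` in the scaled metric. -/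
noncomputable def bAng (n : ℕ) (x y : ZMod n → ℝ) (w0 : ℝ) (w : ZMod n → ℝ) (i : ZMod n) : ℝ :=
  triAngle (Xl n x w0 w (i - 1)) (Yl n y w (i - 1)) (Xl n x w0 w i)

/-- The cone angle `α(w)` at the interior vertex `v₀` of the scaled metric. -/
noncomputable def coneAngle (n : ℕ) [NeZero n] (x y : ZMod n → ℝ) (w0 : ℝ)
    (w : ZMod n → ℝ) : ℝ :=
  ∑ i : ZMod n, cAng n x y w0 w i

/-- Positive reals `p, q, r` satisfying the strict triangle inequalities
(a nondegenerate triangle). -/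
def IsTri (p q r : ℝ) : Prop :=
  0 < p ∧ 0 < q ∧ 0 < r ∧ p < q + r ∧ q < p + r ∧ r < p + q

/-- Sixteen times the squared area of the triangle with side lengths `p`, `q`, `r`. -/
def heronPoly (p q r : ℝ) : ℝ :=
  4 * p ^ 2 * q ^ 2 - (p ^ 2 + q ^ 2 - r ^ 2) ^ 2

lemma heronPoly_rotate (p q r : ℝ) : heronPoly q r p = heronPoly p q r := by
  unfold heronPoly; ring

lemma heronPoly_swap (p q r : ℝ) : heronPoly q p r = heronPoly p q r := by
  unfold heronPoly; ring

lemma IsTri.rotate {p q r : ℝ} (h : IsTri p q r) : IsTri q r p := by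
  obtain ⟨hp, hq, hr, h₁, h₂, h₃⟩ := h
  exact ⟨hq, hr, hp, by linarith, by linarith, by linarith⟩

lemma IsTri.swap {p q r : ℝ} (h : IsTri p q r) : IsTri q p r := by
  obtain ⟨hp, hq, hr, h₁, h₂, h₃⟩ := h
  exact ⟨hq, hp, hr, by linarith, by linarith, by linarith⟩

lemma IsTri.heronPoly_pos {p q r : ℝ} (h : IsTri p q r) : 0 < heronPoly p q r := by
  obtain ⟨hp, hq, hr, h₁, h₂, h₃⟩ := h
  have hfac : heronPoly p q r = (p + q + r) * (p + q - r) * (q + r - p) * (p + r - q) := by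
    unfold heronPoly; ring
  rw [hfac]
  exact mul_pos (mul_pos (mul_pos (by linarith) (by linarith)) (by linarith)) (by linarith)

lemma one_sub_cosLaw_sq {p q : ℝ} (r : ℝ) (hp : 0 < p) (hq : 0 < q) :
    1 - ((p ^ 2 + q ^ 2 - r ^ 2) / (2 * p * q)) ^ 2 = heronPoly p q r / (2 * p * q) ^ 2 := by
  unfold heronPoly
  field_simp
  ring

lemma sqrt_one_sub_cosLaw_sq {p q : ℝ} (r : ℝ) (hp : 0 < p) (hq : 0 < q) :
    √(1 - ((p ^ 2 + q ^ 2 - r ^ 2) / (2 * p * q)) ^ 2) = √(heronPoly p q r) / (2 * p * q) := by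
  rw [one_sub_cosLaw_sq r hp hq, Real.sqrt_div' _ (sq_nonneg _), Real.sqrt_sq (by positivity)]

lemma IsTri.cosLaw_sq_lt_one {p q r : ℝ} (h : IsTri p q r) :
    ((p ^ 2 + q ^ 2 - r ^ 2) / (2 * p * q)) ^ 2 < 1 := by
  have hp := h.1
  have hq := h.2.1
  have hpos : 0 < heronPoly p q r / (2 * p * q) ^ 2 :=
    div_pos h.heronPoly_pos (by positivity)
  linarith [one_sub_cosLaw_sq r hp hq]

/-- The cotangent of an inner angle in terms of the side lengths. -/
lemma IsTri.cot_triAngle {p q r : ℝ} (h : IsTri p q r) :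
    Real.cos (triAngle p q r) / Real.sin (triAngle p q r) =
      (p ^ 2 + q ^ 2 - r ^ 2) / √(heronPoly p q r) := by
  have hp := h.1
  have hq := h.2.1
  have hlt := abs_lt.mp ((sq_lt_one_iff_abs_lt_one _).mp h.cosLaw_sq_lt_one)
  have hs := Real.sqrt_pos.mpr h.heronPoly_pos
  rw [triAngle, Real.cos_arccos hlt.1.le hlt.2.le, Real.sin_arccos,
    sqrt_one_sub_cosLaw_sq r hp hq]
  field_simp

/-- The variation of an inner angle under vertex scaling of a nondegenerate triangle: `u₀` scales
the vertex of the angle, `u₁` and `u₂` the other end points of the sides `p` and `q`. -/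
lemma hasDerivAt_triAngle {p q r : ℝ → ℝ} {t u₀ u₁ u₂ : ℝ}
    (hp : HasDerivAt p (p t * (u₀ + u₁)) t) (hq : HasDerivAt q (q t * (u₀ + u₂)) t)
    (hr : HasDerivAt r (r t * (u₁ + u₂)) t) (h : IsTri (p t) (q t) (r t)) :
    HasDerivAt (fun s => triAngle (p s) (q s) (r s))
      (Real.cos (triAngle (q t) (r t) (p t)) / Real.sin (triAngle (q t) (r t) (p t)) * (u₁ - u₀) +
        Real.cos (triAngle (p t) (r t) (q t)) / Real.sin (triAngle (p t) (r t) (q t)) *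
          (u₂ - u₀)) t := by
  have hp0 := h.1
  have hq0 := h.2.1
  have hs := Real.sqrt_pos.mpr h.heronPoly_pos
  have hlt := abs_lt.mp ((sq_lt_one_iff_abs_lt_one _).mp h.cosLaw_sq_lt_one)
  have hcos := (((hp.fun_pow 2).fun_add (hq.fun_pow 2)).fun_sub (hr.fun_pow 2)).fun_div
    ((hp.const_mul 2).fun_mul hq) (by positivity)
  refine ((Real.hasDerivAt_arccos hlt.1.ne' hlt.2.ne).comp t hcos).congr_deriv ?_
  rw [h.rotate.cot_triAngle, h.swap.rotate.cot_triAngle, heronPoly_rotate (p t), heronPoly_rotate (q t),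
    heronPoly_swap (p t), sqrt_one_sub_cosLaw_sq _ hp0 hq0]
  field_simp
  norm_num
  ring

/-- (Curvature variation formula, Proposition 2.3, at the interior vertex of a star
triangulation.)  If the conformal factors `w₀(t)` (at `v₀`) and `w(t)` (at the boundary
vertices) are differentiable at `t₀` and the scaled triangles are nondegenerate at `t₀`,
then the cone angle `α(t)` at `v₀` is differentiable at `t₀` with derivative
`Σᵢ (cot aᵢ + cot bᵢ)(wᵢ' − w₀')`; equivalently the curvature `K₀ = 2π − α` has
derivative `Σᵢ (cot aᵢ + cot bᵢ)(w₀' − wᵢ')`. -/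
theorem star_curvature_variation
    (n : ℕ) [NeZero n] (hn : 3 ≤ n) (x y : ZMod n → ℝ)
    (hbase : ∀ i : ZMod n, IsGenTri (x i) (x (i + 1)) (y i))
    (w0 : ℝ → ℝ) (w : ℝ → ZMod n → ℝ) (t₀ w0' : ℝ) (w' : ZMod n → ℝ)
    (hw0 : HasDerivAt w0 w0' t₀)
    (hw : ∀ i : ZMod n, HasDerivAt (fun t => w t i) (w' i) t₀)
    (hstrict : ∀ i : ZMod n,
      IsTri (Xl n x (w0 t₀) (w t₀) i) (Xl n x (w0 t₀) (w t₀) (i + 1)) (Yl n y (w t₀) i)) :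
    HasDerivAt (fun t => coneAngle n x y (w0 t) (w t))
      (∑ i : ZMod n,
        (Real.cos (aAng n x y (w0 t₀) (w t₀) i) / Real.sin (aAng n x y (w0 t₀) (w t₀) i) +
          Real.cos (bAng n x y (w0 t₀) (w t₀) i) / Real.sin (bAng n x y (w0 t₀) (w t₀) i)) *
          (w' i - w0')) t₀ ∧
    HasDerivAt (fun t => 2 * π - coneAngle n x y (w0 t) (w t))
      (∑ i : ZMod n,
        (Real.cos (aAng n x y (w0 t₀) (w t₀) i) / Real.sin (aAng n x y (w0 t₀) (w t₀) i) +
          Real.cos (bAng n x y (w0 t₀) (w t₀) i) / Real.sin (bAng n x y (w0 t₀) (w t₀) i)) *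
          (w0' - w' i)) t₀ := by
  have hX (i : ZMod n) : HasDerivAt (fun t => Xl n x (w0 t) (w t) i)
      (Xl n x (w0 t₀) (w t₀) i * (w0' + w' i)) t₀ :=
    ((hw0.fun_add (hw i)).exp.mul_const (x i)).congr_deriv (by unfold Xl; ring)
  have hY (i : ZMod n) : HasDerivAt (fun t => Yl n y (w t) i)
      (Yl n y (w t₀) i * (w' i + w' (i + 1))) t₀ :=
    (((hw i).fun_add (hw (i + 1))).exp.mul_const (y i)).congr_deriv (by unfold Yl; ring)
  have hcone : HasDerivAt (fun t => coneAngle n x y (w0 t) (w t))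
      (∑ i : ZMod n,
        (Real.cos (aAng n x y (w0 t₀) (w t₀) i) / Real.sin (aAng n x y (w0 t₀) (w t₀) i) +
          Real.cos (bAng n x y (w0 t₀) (w t₀) i) / Real.sin (bAng n x y (w0 t₀) (w t₀) i)) *
          (w' i - w0')) t₀ := by
    refine (HasDerivAt.fun_sum fun i _ =>
      hasDerivAt_triAngle (hX i) (hX (i + 1)) (hY i) (hstrict i)).congr_deriv ?_
    simp only [add_mul, Finset.sum_add_distrib]
    congr 1
    refine Fintype.sum_equiv (Equiv.addRight 1) _ _ fun i => ?_
    simp [bAng]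
  refine ⟨hcone, (hcone.const_sub (2 * π)).congr_deriv ?_⟩
  rw [← Finset.sum_neg_distrib]
  exact Finset.sum_congr rfl fun i _ => by ring
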